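/- arXiv:2101.00107 — 2 statements merged into one kernel-verified Lean document; each statement's English description precedes it below -/
import Mathlib

section
/- Let q be a prime power, let A_n be a matrix chosen uniformly at random from GL_n(F_q), and let M_n = A_n − I. Let Q(M_n) = n − rank(M_n), and let Q_∞ be the distribution with P(Q_∞ = k) = q^{-k²} · (∏_{i=k+1}^∞ (1 − q^{-i})) / (∏_{i=1}^{k} (1 − q^{-i})). Then there exist absolute constants C > 0 and c > 0 such that ‖Q(M_n) − Q_∞‖_TV ≤ (C/q)^{cn}. -/
open MeasureTheory ProbabilityTheory Matrix

/-- The limiting corank distribution `Q_∞` for square matrices over a field with `q` elements. -/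
noncomputable def Qinf (q : ℝ) (k : ℕ) : ℝ :=
  (q ^ (k ^ 2))⁻¹ * (∏' i : ℕ, (1 - (q ^ (k + 1 + i))⁻¹)) /
    ∏ i ∈ Finset.range k, (1 - (q ^ (i + 1))⁻¹)

/-- Total variation distance between the law of the ℕ-valued random variable `Q` and the
distribution on ℕ with density `f`. -/
noncomputable def tvDist {Ω : Type*} [MeasureSpace Ω] (Q : Ω → ℕ) (f : ℕ → ℝ) : ℝ :=
  ⨆ A : Set ℕ, |(ℙ (Q ⁻¹' A)).toReal - ∑' k : A, f k|

open Filter Topology Finset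

/-- The `q`-Pochhammer symbol `(x; x)_n`. -/
def qPoch (x : ℝ) (n : ℕ) : ℝ := ∏ i ∈ range n, (1 - x ^ (i + 1))

/-- The Gaussian binomial coefficient with base `x`. -/
def qBinom (x : ℝ) : ℕ → ℕ → ℝ
  | _, 0 => 1
  | 0, _ + 1 => 0
  | n + 1, k + 1 => x ^ (k + 1) * qBinom x n (k + 1) + qBinom x n k

/-- The `i`-th term of the alternating series for the probability that the corank is `k`. -/
noncomputable def corankTerm (x : ℝ) (k i : ℕ) : ℝ :=
  (-1) ^ i * x ^ (k ^ 2 + k * i + (i + 1).choose 2) / (qPoch x k * qPoch x i)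

@[simp] lemma qPoch_zero (x : ℝ) : qPoch x 0 = 1 := by simp [qPoch]

lemma qPoch_succ (x : ℝ) (n : ℕ) : qPoch x (n + 1) = qPoch x n * (1 - x ^ (n + 1)) :=
  prod_range_succ _ _

lemma qPoch_add (x : ℝ) (m n : ℕ) :
    qPoch x (m + n) = qPoch x m * ∏ i ∈ range n, (1 - x ^ (m + i + 1)) :=
  prod_range_add _ _ _

lemma half_pow_le_qPoch {x : ℝ} (h0 : 0 ≤ x) (h1 : x ≤ 1 / 2) (n : ℕ) :
    (1 / 2 : ℝ) ^ n ≤ qPoch x n := by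
  rw [qPoch, ← card_range n, ← prod_const, card_range]
  refine prod_le_prod (fun _ _ => by norm_num) fun i _ => ?_
  have : x ^ (i + 1) ≤ x := pow_le_of_le_one h0 (by linarith) (by simp)
  linarith

lemma qPoch_pos {x : ℝ} (h0 : 0 ≤ x) (h1 : x ≤ 1 / 2) (n : ℕ) : 0 < qPoch x n :=
  (by positivity : (0 : ℝ) < (1 / 2) ^ n).trans_le (half_pow_le_qPoch h0 h1 n)

@[simp] lemma qBinom_zero_right (x : ℝ) (n : ℕ) : qBinom x n 0 = 1 := by
  cases n <;> simp [qBinom]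

lemma qBinom_succ_succ (x : ℝ) (n k : ℕ) :
    qBinom x (n + 1) (k + 1) = x ^ (k + 1) * qBinom x n (k + 1) + qBinom x n k := by
  simp [qBinom]

lemma qBinom_eq_zero_of_lt (x : ℝ) {n k : ℕ} (h : n < k) : qBinom x n k = 0 := by
  induction n generalizing k with
  | zero => obtain _ | k := k <;> simp_all [qBinom]
  | succ n ih =>
    obtain _ | k := k
    · omega
    · rw [qBinom_succ_succ, ih (by omega), ih (by omega)]; simp

@[simp] lemma qBinom_self (x : ℝ) (n : ℕ) : qBinom x n n = 1 := by
  induction n with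
  | zero => simp
  | succ n ih => rw [qBinom_succ_succ, qBinom_eq_zero_of_lt x (by omega), ih]; simp

lemma qBinom_add_mul (x : ℝ) (a b : ℕ) :
    qBinom x (a + b) a * (qPoch x a * qPoch x b) = qPoch x (a + b) := by
  induction hs : a + b generalizing a b with
  | zero =>
    obtain ⟨rfl, rfl⟩ : a = 0 ∧ b = 0 := by omega
    simp
  | succ s ih =>
    obtain _ | a := a
    · obtain rfl : b = s + 1 := by omega
      simp
    obtain _ | b := b
    · obtain rfl : a = s := by omega
      simp
    have h₁ := ih (a + 1) b (by omega)
    have h₂ := ih a (b + 1) (by omega)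
    rw [qPoch_succ] at h₁ h₂
    rw [qBinom_succ_succ, qPoch_succ, qPoch_succ, qPoch_succ]
    have hp : x ^ (s + 1) = x ^ (a + 1) * x ^ (b + 1) := by
      rw [← pow_add]; congr 1; omega
    rw [hp]
    linear_combination x ^ (a + 1) * (1 - x ^ (b + 1)) * h₁ + (1 - x ^ (a + 1)) * h₂

/-- The `q`-binomial theorem. -/
lemma sum_qBinom (x z : ℝ) (n : ℕ) :
    ∑ i ∈ range (n + 1), (-1) ^ i * x ^ (i.choose 2) * z ^ i * qBinom x n i =
      ∏ j ∈ range n, (1 - z * x ^ j) := by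
  induction n generalizing z with
  | zero => simp
  | succ n ih =>
    have h := ih (z * x)
    rw [prod_range_succ']
    have h' : ∏ k ∈ range n, (1 - z * x ^ (k + 1)) = ∏ k ∈ range n, (1 - z * x * x ^ k) :=
      prod_congr rfl fun k _ => by ring
    rw [h', ← h, sum_range_succ']
    have hs : ∀ i, (-1) ^ (i + 1) * x ^ ((i + 1).choose 2) * z ^ (i + 1) *
        qBinom x (n + 1) (i + 1) =
        (-1) ^ (i + 1) * x ^ ((i + 1).choose 2) * (z * x) ^ (i + 1) * qBinom x n (i + 1) -
        z * ((-1) ^ i * x ^ (i.choose 2) * (z * x) ^ i * qBinom x n i) := by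
      intro i
      have hc : (i + 1).choose 2 = i.choose 2 + i := by
        rw [Nat.choose_succ_succ' i 1, Nat.choose_one_right, add_comm]
      rw [qBinom_succ_succ, hc, pow_add x]
      ring
    simp only [hs, sum_sub_distrib, ← mul_sum]
    have e := sum_range_succ' (fun i => (-1) ^ i * x ^ (i.choose 2) * (z * x) ^ i * qBinom x n i)
      (n + 1)
    rw [sum_range_succ, qBinom_eq_zero_of_lt x (Nat.lt_succ_self n)] at e
    simp at e ⊢
    linear_combination -e

lemma qBinom_nonneg {x : ℝ} (h0 : 0 ≤ x) (n k : ℕ) : 0 ≤ qBinom x n k := by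
  induction n generalizing k with
  | zero => obtain _ | k := k <;> simp [qBinom]
  | succ n ih =>
    obtain _ | k := k
    · simp
    · rw [qBinom_succ_succ]
      have := ih (k + 1)
      have := ih k
      positivity

lemma qBinom_le {x : ℝ} (h0 : 0 ≤ x) (h1 : x ≤ 1 / 2) (n k : ℕ) : qBinom x n k ≤ 2 ^ k := by
  induction n generalizing k with
  | zero => obtain _ | k := k <;> simp [qBinom]
  | succ n ih =>
    obtain _ | k := k
    · simp
    · rw [qBinom_succ_succ]
      have h₁ : x ^ (k + 1) * qBinom x n (k + 1) ≤ (1 / 2) ^ (k + 1) * 2 ^ (k + 1) := by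
        gcongr
        · exact qBinom_nonneg h0 _ _
        · exact ih _
      rw [← mul_pow] at h₁
      rw [show (1 / 2 * 2 : ℝ) = 1 by norm_num, one_pow] at h₁
      have h₂ := ih k
      have h₃ : (1 : ℝ) ≤ 2 ^ k := one_le_pow₀ (by norm_num)
      rw [pow_succ (2 : ℝ)]
      linarith

lemma tendsto_qBinom {x : ℝ} (h0 : 0 ≤ x) (h1 : x ≤ 1 / 2) (k : ℕ) :
    Tendsto (fun n => qBinom x n k) atTop (𝓝 (qPoch x k)⁻¹) := by
  rw [← tendsto_add_atTop_iff_nat k]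
  have h : ∀ n, qBinom x (n + k) k = (∏ i ∈ range k, (1 - x ^ (n + i + 1))) * (qPoch x k)⁻¹ := by
    intro n
    have h := qBinom_add_mul x k n
    have hk := (qPoch_pos h0 h1 k).ne'
    have hn := (qPoch_pos h0 h1 n).ne'
    rw [add_comm k n, qPoch_add x n k] at h
    field_simp
    apply mul_left_cancel₀ hn
    linear_combination h
  simp only [h]
  have : Tendsto (fun n => ∏ i ∈ range k, (1 - x ^ (n + i + 1))) atTop
      (𝓝 (∏ i ∈ range k, (1 - 0))) := by
    refine tendsto_finsetProd _ fun i _ => tendsto_const_nhds.sub ?_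
    have := tendsto_pow_atTop_nhds_zero_of_lt_one h0 (by linarith : x < 1)
    simpa only [add_assoc] using (tendsto_add_atTop_iff_nat (i + 1)).2 this
  simpa using this.mul_const _

lemma le_choose_succ_two (i : ℕ) : i ≤ (i + 1).choose 2 := by
  rw [Nat.choose_succ_succ' i 1, Nat.choose_one_right]; omega

lemma abs_corankTerm_le {x : ℝ} (h0 : 0 ≤ x) (h1 : x ≤ 1 / 2) (k i : ℕ) :
    |corankTerm x k i| ≤ (2 * x) ^ (k + i) := by
  have hk := half_pow_le_qPoch h0 h1 k
  have hi := half_pow_le_qPoch h0 h1 i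
  have hk' := qPoch_pos h0 h1 k
  have hi' := qPoch_pos h0 h1 i
  rw [corankTerm, abs_div, abs_mul, abs_pow, abs_neg, abs_one, one_pow, one_mul, abs_pow,
    abs_of_nonneg h0, abs_of_pos (mul_pos hk' hi'), div_le_iff₀ (mul_pos hk' hi')]
  calc x ^ (k ^ 2 + k * i + (i + 1).choose 2) ≤ x ^ (k + i) := by
        apply pow_le_pow_of_le_one h0 (by linarith)
        have := le_choose_succ_two i
        nlinarith [Nat.le_self_pow two_ne_zero k]
    _ = (2 * x) ^ (k + i) * ((1 / 2) ^ k * (1 / 2) ^ i) := by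
        rw [← pow_add, ← mul_pow]; congr 1; ring
    _ ≤ _ := by gcongr

lemma summable_pow_choose_two {x : ℝ} (h0 : 0 ≤ x) (h1 : x < 1) :
    Summable fun i : ℕ => x ^ (i.choose 2) := by
  rw [← summable_nat_add_iff 1]
  exact (summable_geometric_of_lt_one h0 h1).of_nonneg_of_le (fun i => by positivity)
    fun i => pow_le_pow_of_le_one h0 h1.le (le_choose_succ_two i)

lemma norm_euler_term_le {x c : ℝ} (h0 : 0 ≤ x) (h1 : x ≤ 1 / 2) (k i : ℕ) (hc0 : 0 ≤ c)
    (hc : c ≤ 2 ^ i) :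
    ‖(-1) ^ i * x ^ (i.choose 2) * (x ^ (k + 1)) ^ i * c‖ ≤ x ^ (i.choose 2) := by
  rw [norm_mul, norm_mul, norm_mul, norm_pow, norm_neg, norm_one, one_pow, one_mul,
    Real.norm_of_nonneg (by positivity), Real.norm_of_nonneg (by positivity),
    Real.norm_of_nonneg hc0, mul_assoc]
  refine mul_le_of_le_one_right (by positivity) ?_
  have hx : x ^ (k + 1) ≤ 1 / 2 := (pow_le_of_le_one h0 (by linarith) (by simp)).trans h1
  calc (x ^ (k + 1)) ^ i * c ≤ (1 / 2) ^ i * 2 ^ i := by gcongr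
    _ = 1 := by rw [← mul_pow]; norm_num

/-- Euler's expansion of `∏ (1 - x ^ (k + 1 + i))`. -/
lemma hasSum_euler {x : ℝ} (h0 : 0 ≤ x) (h1 : x ≤ 1 / 2) (k : ℕ) :
    HasSum (fun i : ℕ => (-1) ^ i * x ^ (i.choose 2) * (x ^ (k + 1)) ^ i * (qPoch x i)⁻¹)
      (∏' i : ℕ, (1 - x ^ (k + 1 + i))) := by
  have hx1 : x < 1 := by linarith
  have hT := tendsto_tsum_of_dominated_convergence (𝓕 := atTop)
    (f := fun n i => (-1) ^ i * x ^ (i.choose 2) * (x ^ (k + 1)) ^ i * qBinom x n i)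
    (g := fun i => (-1) ^ i * x ^ (i.choose 2) * (x ^ (k + 1)) ^ i * (qPoch x i)⁻¹)
    (summable_pow_choose_two h0 hx1)
    (fun i => (tendsto_qBinom h0 h1 i).const_mul _)
    (.of_forall fun n i => norm_euler_term_le h0 h1 k i (qBinom_nonneg h0 _ _)
      (qBinom_le h0 h1 _ _))
  have hfin : ∀ n, ∑' i, (-1) ^ i * x ^ (i.choose 2) * (x ^ (k + 1)) ^ i * qBinom x n i =
      ∏ j ∈ range n, (1 - x ^ (k + 1 + j)) := by
    intro n
    rw [tsum_eq_sum (s := range (n + 1)) fun i hi => by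
      rw [qBinom_eq_zero_of_lt x (by simpa using hi), mul_zero], sum_qBinom]
    exact prod_congr rfl fun j _ => by rw [pow_add x (k + 1) j]
  simp only [hfin] at hT
  have hm : Multipliable fun i : ℕ => 1 - x ^ (k + 1 + i) := by
    simp only [sub_eq_add_neg]
    refine Real.multipliable_one_add_of_summable (Summable.neg ?_)
    simp only [pow_add x (k + 1)]
    exact (summable_geometric_of_lt_one h0 hx1).mul_left _
  rw [← tendsto_nhds_unique hT hm.hasProd.tendsto_prod_nat]
  refine (Summable.of_norm_bounded (summable_pow_choose_two h0 hx1) fun i =>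
    norm_euler_term_le h0 h1 k i (inv_nonneg.2 (qPoch_pos h0 h1 i).le) ?_).hasSum
  have h := inv_anti₀ (by positivity) (half_pow_le_qPoch h0 h1 i)
  simpa using h

lemma hasSum_corankTerm {q : ℝ} (hq : 2 ≤ q) (k : ℕ) :
    HasSum (corankTerm q⁻¹ k) (Qinf q k) := by
  have h0 : 0 ≤ q⁻¹ := by positivity
  have h1 : q⁻¹ ≤ 1 / 2 := by rw [one_div]; exact inv_anti₀ two_pos hq
  have h := (hasSum_euler h0 h1 k).mul_left ((q⁻¹) ^ (k ^ 2) / qPoch q⁻¹ k)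
  have hf : corankTerm q⁻¹ k = fun i => q⁻¹ ^ (k ^ 2) / qPoch q⁻¹ k *
      ((-1) ^ i * q⁻¹ ^ (i.choose 2) * (q⁻¹ ^ (k + 1)) ^ i * (qPoch q⁻¹ i)⁻¹) := by
    funext i
    have hc : (i + 1).choose 2 = i.choose 2 + i := by
      rw [Nat.choose_succ_succ' i 1, Nat.choose_one_right, add_comm]
    rw [corankTerm, hc, div_eq_mul_inv, mul_inv]
    ring
  have hQ : Qinf q k = q⁻¹ ^ (k ^ 2) / qPoch q⁻¹ k * ∏' i : ℕ, (1 - q⁻¹ ^ (k + 1 + i)) := by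
    simp only [Qinf, qPoch, inv_pow]
    ring
  rw [hf, hQ]
  exact h

lemma prod_pow_sub_mul_qPoch {q : ℝ} (hq : q ≠ 0) (b j : ℕ) :
    (∏ i ∈ range j, (q ^ (b + j) - q ^ i)) * qPoch q⁻¹ b =
      q ^ ((b + j) * j) * qPoch q⁻¹ (b + j) := by
  have h : ∏ i ∈ range j, (q ^ (b + j) - q ^ i) =
      ∏ i ∈ range j, (q ^ (b + j) * (1 - q⁻¹ ^ (b + i + 1))) := by
    rw [← prod_range_reflect]
    refine prod_congr rfl fun i hi => ?_
    have hi := mem_range.1 hi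
    have e : q ^ (b + j) = q ^ (j - 1 - i) * q ^ (b + i + 1) := by
      rw [← pow_add]; congr 1; omega
    rw [mul_sub, mul_one]
    congr 1
    rw [e, inv_pow, mul_assoc, mul_inv_cancel₀ (by positivity), mul_one]
  rw [h, prod_mul_distrib, prod_const, card_range, qPoch_add, pow_mul]
  ring

/-- Inversion of the moments `∏ (q ^ m - q ^ j)`. -/
lemma sum_corankTerm_mul_prod {q : ℝ} (hq : 2 ≤ q) {m r M : ℕ} (h : m < r + M) :
    ∑ i ∈ range M, corankTerm q⁻¹ r i * ∏ j ∈ range (r + i), (q ^ m - q ^ j) =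
      if m = r then 1 else 0 := by
  have hq0 : q ≠ 0 := by positivity
  have h0 : 0 ≤ q⁻¹ := by positivity
  have h1 : q⁻¹ ≤ 1 / 2 := by rw [one_div]; exact inv_anti₀ two_pos hq
  have hzero : ∀ i, m < r + i → corankTerm q⁻¹ r i * ∏ j ∈ range (r + i), (q ^ m - q ^ j) = 0 :=
    fun i hi => by rw [prod_eq_zero (mem_range.2 hi) (sub_self _), mul_zero]
  obtain hm | hm := lt_or_ge m r
  · rw [if_neg (by omega)]
    exact sum_eq_zero fun i _ => hzero i (by omega)
  obtain ⟨N, rfl⟩ := Nat.exists_eq_add_of_le hm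
  have hterm : ∀ i ∈ range (N + 1),
      corankTerm q⁻¹ r i * ∏ j ∈ range (r + i), (q ^ (r + N) - q ^ j) =
        q ^ (N * r) * qPoch q⁻¹ (r + N) / (qPoch q⁻¹ r * qPoch q⁻¹ N) *
          ((-1) ^ i * q⁻¹ ^ (i.choose 2) * (q⁻¹ * q ^ N) ^ i * qBinom q⁻¹ N i) := by
    intro i hi
    obtain ⟨b, rfl⟩ := Nat.exists_eq_add_of_le (Nat.lt_succ_iff.1 (mem_range.1 hi))
    have e₁ := prod_pow_sub_mul_qPoch hq0 b (r + i)
    have e₂ := qBinom_add_mul q⁻¹ i b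
    rw [show b + (r + i) = r + (i + b) by ring] at e₁
    have hb := (qPoch_pos h0 h1 b).ne'
    have hr := (qPoch_pos h0 h1 r).ne'
    have hi := (qPoch_pos h0 h1 i).ne'
    have hib := (qPoch_pos h0 h1 (i + b)).ne'
    have hc : (i + 1).choose 2 = i.choose 2 + i := by
      rw [Nat.choose_succ_succ' i 1, Nat.choose_one_right, add_comm]
    rw [eq_div_of_mul_eq hb e₁, eq_div_of_mul_eq (mul_ne_zero hi hb) e₂, corankTerm, hc]
    have e₃ : q⁻¹ ^ (r ^ 2 + r * i + (i.choose 2 + i)) * q ^ ((r + (i + b)) * (r + i)) =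
        q ^ ((i + b) * r) * (q⁻¹ ^ i.choose 2 * (q⁻¹ * q ^ (i + b)) ^ i) := by
      rw [show (r + (i + b)) * (r + i) = (r ^ 2 + r * i) + ((i + b) * r + (i + b) * i) by ring,
        pow_add q⁻¹, pow_add q⁻¹ (i.choose 2), pow_add q (r ^ 2 + r * i), pow_add q ((i + b) * r),
        mul_pow, ← pow_mul q (i + b), inv_pow q (r ^ 2 + r * i)]
      field_simp
    generalize qPoch q⁻¹ r = u at *
    generalize qPoch q⁻¹ i = v at *
    generalize qPoch q⁻¹ b = w at *
    generalize qPoch q⁻¹ (i + b) = t at *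
    generalize q⁻¹ ^ (r ^ 2 + r * i + (i.choose 2 + i)) = c₁ at *
    generalize q⁻¹ ^ i.choose 2 = c₂ at *
    generalize (q⁻¹ * q ^ (i + b)) ^ i = c₃ at *
    generalize q ^ ((r + (i + b)) * (r + i)) = c₄ at *
    generalize qPoch q⁻¹ (r + (i + b)) = y at *
    field_simp
    linear_combination y * e₃
  rw [← sum_subset (range_subset_range.2 (by omega : N + 1 ≤ M)) fun i _ hi =>
    hzero i (by simp at hi; omega), sum_congr rfl hterm, ← mul_sum, sum_qBinom]
  obtain _ | N := N
  · simp [(qPoch_pos h0 h1 r).ne']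
  · rw [if_neg (by omega), prod_eq_zero (self_mem_range_succ N), mul_zero]
    rw [pow_succ, inv_pow]
    field_simp
    simp

/-- The probability that a uniform element of `GL_n` minus the identity has corank `k`, with
`x = q⁻¹`. -/
noncomputable def corankProb (x : ℝ) (n k : ℕ) : ℝ := ∑ i ∈ range (n + 1 - k), corankTerm x k i

lemma corankProb_eq_zero_of_lt (x : ℝ) {n k : ℕ} (h : n < k) : corankProb x n k = 0 := by
  simp [corankProb, Nat.sub_eq_zero_of_le (Nat.succ_le_of_lt h)]

/-- A law on `{0, …, n}` whose first `n` moments are `1` is given by `corankProb`. -/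
lemma card_filter_eq_div_card {G : Type*} [Fintype G] [Nonempty G] {q : ℝ} (hq : 2 ≤ q) {n : ℕ}
    {f : G → ℕ} (hf : ∀ g, f g ≤ n)
    (hm : ∀ k ≤ n, ∑ g, ∏ i ∈ range k, (q ^ f g - q ^ i) = Fintype.card G) (r : ℕ) :
    (#{g | f g = r} : ℝ) / Fintype.card G = corankProb q⁻¹ n r := by
  obtain hr | hr := lt_or_ge n r
  · rw [corankProb_eq_zero_of_lt _ hr, filter_false_of_mem fun g _ => by have := hf g; omega]
    simp
  have hG : (Fintype.card G : ℝ) ≠ 0 := by positivity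
  rw [div_eq_iff hG, corankProb, sum_mul, card_filter, Nat.cast_sum]
  have : ∀ g, ((if f g = r then 1 else 0 : ℕ) : ℝ) = ∑ i ∈ range (n + 1 - r),
      corankTerm q⁻¹ r i * ∏ j ∈ range (r + i), (q ^ f g - q ^ j) := by
    intro g
    rw [sum_corankTerm_mul_prod hq (by have := hf g; omega)]
    simp
  simp only [this]
  rw [sum_comm]
  refine sum_congr rfl fun i hi => ?_
  rw [← mul_sum, hm _ (by have := mem_range.1 hi; omega)]

lemma tendsto_corankProb {q : ℝ} (hq : 2 ≤ q) (k : ℕ) :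
    Tendsto (fun n => corankProb q⁻¹ n k) atTop (𝓝 (Qinf q k)) :=
  (hasSum_corankTerm hq k).tendsto_sum_nat.comp
    ((tendsto_sub_atTop_nat k).comp (tendsto_add_atTop_nat 1))

lemma abs_corankProb_sub_Qinf_le {q : ℝ} (hq : 8 ≤ q) (n k : ℕ) :
    |corankProb q⁻¹ n k - Qinf q k| ≤ 4 / 3 * (2 * q⁻¹) ^ (k + (n + 1 - k)) := by
  have h0 : 0 ≤ q⁻¹ := by positivity
  have h1 : q⁻¹ ≤ 1 / 8 := by rw [one_div]; exact inv_anti₀ (by norm_num) hq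
  have hs := hasSum_corankTerm (by linarith : 2 ≤ q) k
  set y := 2 * q⁻¹ with hy
  have hg := (hasSum_geometric_of_lt_one (by positivity : 0 ≤ y) (by linarith)).mul_left
    (y ^ (k + (n + 1 - k)))
  rw [← hs.tsum_eq, ← hs.summable.sum_add_tsum_nat_add (n + 1 - k), corankProb, sub_add_cancel_left,
    abs_neg]
  calc _ ≤ y ^ (k + (n + 1 - k)) * (1 - y)⁻¹ :=
        tsum_of_norm_bounded (f := fun i => corankTerm q⁻¹ k (i + (n + 1 - k))) hg fun i => by
          rw [← pow_add, add_assoc, add_comm (n + 1 - k)]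
          exact abs_corankTerm_le h0 (by linarith) k _
    _ ≤ y ^ (k + (n + 1 - k)) * (4 / 3) := by
        gcongr
        rw [inv_le_comm₀ (by linarith) (by norm_num)]
        linarith
    _ = _ := mul_comm _ _

lemma summable_and_tsum_bound {y : ℝ} (h0 : 0 ≤ y) (h1 : y ≤ 1 / 4) (n : ℕ) :
    Summable (fun k => 4 / 3 * y ^ (k + (n + 1 - k))) ∧
      ∑' k, 4 / 3 * y ^ (k + (n + 1 - k)) ≤ (4 * y) ^ (n + 1) := by
  have ht : ∀ k, 4 / 3 * y ^ (k + (n + 1) + (n + 1 - (k + (n + 1)))) =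
      4 / 3 * y ^ (n + 1) * y ^ k := fun k => by
    rw [show k + (n + 1) + (n + 1 - (k + (n + 1))) = n + 1 + k by omega, pow_add]; ring
  have hg := (hasSum_geometric_of_lt_one h0 (by linarith)).mul_left (4 / 3 * y ^ (n + 1))
  have hs : Summable (fun k => 4 / 3 * y ^ (k + (n + 1 - k))) := by
    rw [← summable_nat_add_iff (n + 1)]
    simp only [ht]
    exact hg.summable
  refine ⟨hs, ?_⟩
  rw [← hs.sum_add_tsum_nat_add (n + 1)]
  simp only [ht]
  rw [hg.tsum_eq, sum_congr rfl (g := fun _ => 4 / 3 * y ^ (n + 1)) fun k hk => by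
    rw [show k + (n + 1 - k) = n + 1 by have := mem_range.1 hk; omega], sum_const, card_range,
    nsmul_eq_mul]
  have hi : (1 - y)⁻¹ ≤ 4 / 3 := by
    rw [inv_le_comm₀ (by linarith) (by norm_num)]
    linarith
  have h4 : 2 * ((n : ℝ) + 2) ≤ 4 ^ (n + 1) := by
    have := one_add_mul_le_pow (by norm_num : (-2 : ℝ) ≤ 3) (n + 1)
    norm_num at this
    have hn : (0 : ℝ) ≤ n := n.cast_nonneg
    linarith
  rw [mul_pow]
  calc _ ≤ ((n + 1 : ℕ) : ℝ) * (4 / 3 * y ^ (n + 1)) + 4 / 3 * y ^ (n + 1) * (4 / 3) := by gcongr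
    _ ≤ 2 * ((n : ℝ) + 2) * y ^ (n + 1) := by
        have hn : (0 : ℝ) ≤ n := n.cast_nonneg
        have hy : 0 ≤ y ^ (n + 1) := by positivity
        push_cast
        nlinarith [mul_nonneg hn hy]
    _ ≤ _ := by gcongr

section Algebra

variable {n : ℕ} {F : Type} [Field F]

/-- The action of `GL_n` on linearly independent `k`-tuples of vectors. -/
instance frameAction (n k : ℕ) (F : Type) [Field F] :
    MulAction (GL (Fin n) F) {s : Fin k → Fin n → F // LinearIndependent F s} where
  smul g s := ⟨fun i => (g : Matrix (Fin n) (Fin n) F) *ᵥ s.1 i, by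
    have h := s.2.map' (g : Matrix (Fin n) (Fin n) F).mulVecLin
      (LinearMap.ker_eq_bot.2 (Matrix.mulVec_injective_of_isUnit g.isUnit))
    exact h⟩
  one_smul s := Subtype.ext <| funext fun i => by
    change ((1 : GL (Fin n) F) : Matrix (Fin n) (Fin n) F) *ᵥ s.1 i = s.1 i
    simp
  mul_smul g h s := Subtype.ext <| funext fun i => by
    change ((g * h : GL (Fin n) F) : Matrix (Fin n) (Fin n) F) *ᵥ s.1 i =
      (g : Matrix (Fin n) (Fin n) F) *ᵥ ((h : Matrix (Fin n) (Fin n) F) *ᵥ s.1 i)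
    simp [Matrix.mulVec_mulVec]

lemma coe_frame_smul {k : ℕ} (g : GL (Fin n) F)
    (s : {s : Fin k → Fin n → F // LinearIndependent F s}) (i : Fin k) :
    (g • s).1 i = (g : Matrix (Fin n) (Fin n) F) *ᵥ s.1 i := rfl

instance isPretransitive_frame (n k : ℕ) (F : Type) [Field F] :
    MulAction.IsPretransitive (GL (Fin n) F)
      {s : Fin k → Fin n → F // LinearIndependent F s} where
  exists_smul_eq s t := by
    let f := s.2.linearCombinationEquiv.symm ≪≫ₗ t.2.linearCombinationEquiv
    obtain ⟨g, hg⟩ := Submodule.exists_linearEquiv_restrict_eq f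
    refine ⟨Matrix.GeneralLinearGroup.toLin.symm
      ((LinearMap.GeneralLinearGroup.generalLinearEquiv F (Fin n → F)).symm g), ?_⟩
    refine Subtype.ext <| funext fun i => ?_
    rw [coe_frame_smul, ← Matrix.mulVecLin_apply, ← Matrix.GeneralLinearGroup.coe_toLin,
      MulEquiv.apply_symm_apply]
    have hs : (s.2.linearCombinationEquiv (Finsupp.single i 1) : Fin n → F) = s.1 i := by simp
    have ht : (t.2.linearCombinationEquiv (Finsupp.single i 1) : Fin n → F) = t.1 i := by simp
    change g (s.1 i) = t.1 i
    rw [← hs, ← hg, ← ht]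
    simp [f]

lemma finrank_ker_mulVecLin (M : Matrix (Fin n) (Fin n) F) :
    Module.finrank F (LinearMap.ker M.mulVecLin) = n - M.rank := by
  have h := M.mulVecLin.finrank_range_add_finrank_ker
  rw [Module.finrank_fintype_fun_eq_card, Fintype.card_fin] at h
  rw [Matrix.rank]
  omega

/-- Linearly independent tuples fixed by `g` are the linearly independent tuples in
`ker (g - 1)`. -/
def fixedByFrameEquiv (k : ℕ) (g : GL (Fin n) F) :
    MulAction.fixedBy {s : Fin k → Fin n → F // LinearIndependent F s} g ≃
      {s : Fin k → LinearMap.ker ((g : Matrix (Fin n) (Fin n) F) - 1).mulVecLin //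
        LinearIndependent F s} where
  toFun s := ⟨fun i => ⟨s.1.1 i, by
      have h := congrFun (congrArg Subtype.val s.2) i
      rw [coe_frame_smul] at h
      simp [h]⟩,
    LinearIndependent.of_comp (Submodule.subtype _) s.1.2⟩
  invFun s := ⟨⟨fun i => s.1 i, s.2.map' (Submodule.subtype _) (Submodule.ker_subtype _)⟩, by
    refine Subtype.ext <| funext fun i => ?_
    rw [coe_frame_smul]
    have h := (s.1 i).2
    rw [LinearMap.mem_ker, Matrix.mulVecLin_apply, Matrix.sub_mulVec, Matrix.one_mulVec,
      sub_eq_zero] at h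
    exact h⟩
  left_inv _ := rfl
  right_inv _ := rfl

variable [Fintype F]

lemma natCard_linearIndependent (V : Type) [AddCommGroup V] [Module F V] [Finite V] (k : ℕ) :
    (Nat.card {s : Fin k → V // LinearIndependent F s} : ℝ) =
      ∏ i ∈ range k, ((Fintype.card F : ℝ) ^ Module.finrank F V - (Fintype.card F : ℝ) ^ i) := by
  obtain hk | hk := le_or_gt k (Module.finrank F V)
  · rw [card_linearIndependent hk, Nat.cast_prod, ← Fin.prod_univ_eq_prod_range]
    refine prod_congr rfl fun i _ => ?_
    rw [Nat.cast_sub (Nat.pow_le_pow_right Fintype.card_pos (by omega))]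
    push_cast
    rfl
  · rw [prod_eq_zero (mem_range.2 hk) (sub_self _)]
    have : IsEmpty {s : Fin k → V // LinearIndependent F s} :=
      ⟨fun s => by simpa using s.2.fintype_card_le_finrank.trans_lt hk⟩
    simp

/-- The factorial moments of the size of the fixed space of a uniform element of `GL_n`. -/
lemma sum_prod_card_pow_corank_sub [DecidableEq F] {k : ℕ} (hk : k ≤ n) :
    ∑ g : GL (Fin n) F, ∏ i ∈ range k,
      ((Fintype.card F : ℝ) ^ (n - ((g : Matrix (Fin n) (Fin n) F) - 1).rank) -
        (Fintype.card F : ℝ) ^ i) = Fintype.card (GL (Fin n) F) := by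
  classical
  have hF (g : GL (Fin n) F) := Fintype.ofFinite
    (MulAction.fixedBy {s : Fin k → Fin n → F // LinearIndependent F s} g)
  have hO := Fintype.ofFinite (Quotient <| MulAction.orbitRel (GL (Fin n) F)
    {s : Fin k → Fin n → F // LinearIndependent F s})
  have hne : Nonempty {s : Fin k → Fin n → F // LinearIndependent F s} :=
    ⟨⟨fun i => Pi.basisFun F (Fin n) (Fin.castLE hk i),
      (Pi.basisFun F (Fin n)).linearIndependent.comp _ (Fin.castLE_injective hk)⟩⟩
  have hB := MulAction.sum_card_fixedBy_eq_card_orbits_mul_card_group (GL (Fin n) F)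
    {s : Fin k → Fin n → F // LinearIndependent F s}
  have hone : Fintype.card (Quotient <| MulAction.orbitRel (GL (Fin n) F)
      {s : Fin k → Fin n → F // LinearIndependent F s}) = 1 := by
    rw [Fintype.card_eq_one_iff_nonempty_unique]
    have := (MulAction.pretransitive_iff_subsingleton_quotient (GL (Fin n) F)
      {s : Fin k → Fin n → F // LinearIndependent F s}).1 inferInstance
    exact ⟨⟨⟨⟦hne.some⟧⟩, fun _ => this.elim _ _⟩⟩
  rw [hone, one_mul] at hB
  rw [← hB, Nat.cast_sum]
  refine sum_congr rfl fun g _ => ?_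
  rw [← Nat.card_eq_fintype_card (α := MulAction.fixedBy _ g), Nat.card_congr (fixedByFrameEquiv k g),
    natCard_linearIndependent, finrank_ker_mulVecLin]

end Algebra

/-- A variable which is uniform on a finite type in the sense of point masses has the uniform law,
with no measurability assumption. -/
lemma toReal_preimage_eq_of_uniform {Ω G : Type*} [MeasurableSpace Ω] {μ : Measure Ω}
    [IsProbabilityMeasure μ] [Fintype G] {A : Ω → G}
    (hA : ∀ g, μ {ω | A ω = g} = (Fintype.card G : ENNReal)⁻¹) (S : Set G) [DecidablePred (· ∈ S)] :
    (μ (A ⁻¹' S)).toReal = (#{g | g ∈ S} : ℝ) / Fintype.card G := by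
  classical
  have hle : ∀ (T : Finset G), (μ (A ⁻¹' T)).toReal ≤ (#T : ℝ) / Fintype.card G := by
    intro T
    have hT : A ⁻¹' T = ⋃ g ∈ T, {ω | A ω = g} := by ext ω; simp
    have h := measureReal_biUnion_finset_le (μ := μ) T fun g => {ω | A ω = g}
    simp only [Measure.real, hA, ENNReal.toReal_inv, ENNReal.toReal_natCast, sum_const,
      nsmul_eq_mul] at h
    rw [hT, div_eq_mul_inv]
    exact h
  obtain ⟨ω⟩ := μ.nonempty_of_neZero
  have hG : (0 : ℝ) < Fintype.card G := by
    have : Nonempty G := ⟨A ω⟩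
    positivity
  have h₁ := hle {g | g ∈ S}
  have h₂ := hle ({g | g ∈ S} : Finset G)ᶜ
  rw [card_compl, Nat.cast_sub (card_le_univ _), sub_div, div_self hG.ne'] at h₂
  have h₃ : 1 ≤ (μ (A ⁻¹' S)).toReal + (μ (A ⁻¹' Sᶜ)).toReal := by
    have h := measureReal_union_le (μ := μ) (A ⁻¹' S) (A ⁻¹' Sᶜ)
    rwa [← Set.preimage_union, Set.union_compl_self, Set.preimage_univ, probReal_univ] at h
  simp only [coe_compl, coe_filter, mem_univ, true_and, Set.ofPred_mem_eq] at h₁ h₂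
  exact le_antisymm h₁ (by linarith)

/-- The corank of `g - 1`. -/
noncomputable def fixedCorank {n : ℕ} {F : Type} [Field F] (g : GL (Fin n) F) : ℕ :=
  n - ((g : Matrix (Fin n) (Fin n) F) - 1).rank

section Law

lemma two_le_card_real (F : Type) [Field F] [Fintype F] : (2 : ℝ) ≤ Fintype.card F := by
  exact_mod_cast Fintype.one_lt_card (α := F)

variable (n : ℕ) (F : Type) [Field F] [Fintype F] [DecidableEq F]

lemma card_fixedCorank_eq_div (k : ℕ) :
    (#{g : GL (Fin n) F | fixedCorank g = k} : ℝ) / Fintype.card (GL (Fin n) F) =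
      corankProb (Fintype.card F : ℝ)⁻¹ n k :=
  card_filter_eq_div_card (two_le_card_real F) (fun _ => Nat.sub_le _ _)
    (fun _ hk => sum_prod_card_pow_corank_sub hk) k

lemma corankProb_nonneg (k : ℕ) : 0 ≤ corankProb (Fintype.card F : ℝ)⁻¹ n k := by
  rw [← card_fixedCorank_eq_div]
  positivity

lemma sum_corankProb (s : Finset ℕ) : ∑ k ∈ s, corankProb (Fintype.card F : ℝ)⁻¹ n k =
    (#{g : GL (Fin n) F | fixedCorank g ∈ s} : ℝ) / Fintype.card (GL (Fin n) F) := by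
  simp only [← card_fixedCorank_eq_div, ← sum_div]
  rw [card_eq_sum_card_fiberwise (f := fixedCorank) (t := s) (by intro g; simp), Nat.cast_sum]
  congr 1
  refine sum_congr rfl fun k hk => ?_
  rw [filter_filter]
  congr 2
  ext g
  simp only [mem_filter, mem_univ, true_and]
  exact ⟨fun h => ⟨h ▸ hk, h⟩, fun h => h.2⟩

lemma sum_corankProb_le_one (s : Finset ℕ) :
    ∑ k ∈ s, corankProb (Fintype.card F : ℝ)⁻¹ n k ≤ 1 := by
  rw [sum_corankProb]
  exact div_le_one_of_le₀ (by exact_mod_cast card_le_univ _) (by positivity)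

lemma Qinf_nonneg (k : ℕ) : 0 ≤ Qinf (Fintype.card F) k :=
  ge_of_tendsto' (tendsto_corankProb (two_le_card_real F) k) fun n => corankProb_nonneg n F k

lemma sum_Qinf_le_one (s : Finset ℕ) : ∑ k ∈ s, Qinf (Fintype.card F) k ≤ 1 :=
  le_of_tendsto' (tendsto_finsetSum s fun k _ => tendsto_corankProb (two_le_card_real F) k)
    fun n => sum_corankProb_le_one n F s

lemma summable_Qinf : Summable (Qinf (Fintype.card F)) :=
  summable_of_sum_le (Qinf_nonneg F) (sum_Qinf_le_one F)

lemma hasSum_corankProb_indicator (S : Set ℕ) [DecidablePred (· ∈ S)] :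
    HasSum (S.indicator (corankProb (Fintype.card F : ℝ)⁻¹ n))
      ((#{g : GL (Fin n) F | fixedCorank g ∈ S} : ℝ) / Fintype.card (GL (Fin n) F)) := by
  have h := hasSum_sum_of_ne_finset_zero (L := .unconditional ℕ) (s := {k ∈ range (n + 1) | k ∈ S})
    (f := S.indicator (corankProb (Fintype.card F : ℝ)⁻¹ n)) fun k hk => by
      by_cases hS : k ∈ S
      · rw [Set.indicator_of_mem hS, corankProb_eq_zero_of_lt]
        simp [hS] at hk
        omega
      · exact Set.indicator_of_notMem hS _
  rw [sum_congr rfl fun k hk => Set.indicator_of_mem (mem_filter.1 hk).2 _, sum_corankProb] at h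
  convert h using 4
  ext g
  have : fixedCorank g ≤ n := Nat.sub_le _ _
  simp [this]

end Law

/-- **Perturbation of `GL_n`:** if `A_n` is uniform on `GL_n(F_q)` and `M_n = A_n − I`, then the
corank of `M_n` is close to `Q_∞` in total variation. -/
theorem rank_GL_minus_id :
    ∃ C > (0 : ℝ), ∃ c > (0 : ℝ),
      ∀ (n : ℕ) (F : Type) [Field F] [Fintype F] [DecidableEq F]
        (Ω : Type) [MeasureSpace Ω], IsProbabilityMeasure (ℙ : Measure Ω) →
      ∀ A : Ω → GL (Fin n) F,
        -- A is uniformly distributed on GL_n(F_q)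
        (∀ B : GL (Fin n) F,
          ℙ {ω | A ω = B} = ((Fintype.card (GL (Fin n) F) : ENNReal))⁻¹) →
        tvDist (fun ω => n - ((A ω : Matrix (Fin n) (Fin n) F) - 1).rank)
            (Qinf (Fintype.card F)) ≤
          (C / (Fintype.card F : ℝ)) ^ (c * n) := by
  refine ⟨8, by norm_num, 1, one_pos, fun n F _ _ _ Ω _ hP A hA => ?_⟩
  classical
  have hq2 := two_le_card_real F
  refine ciSup_le fun S => ?_
  have hlaw : (ℙ ((fun ω => n - ((A ω : Matrix (Fin n) (Fin n) F) - 1).rank) ⁻¹' S)).toReal =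
      (#{g : GL (Fin n) F | fixedCorank g ∈ S} : ℝ) / Fintype.card (GL (Fin n) F) :=
    toReal_preimage_eq_of_uniform hA (fixedCorank ⁻¹' S)
  rw [hlaw, _root_.tsum_subtype, one_mul, Real.rpow_natCast]
  have hsI := (summable_Qinf F).indicator S
  obtain hq | hq := le_total (Fintype.card F : ℝ) 8
  · refine le_trans ?_ (one_le_pow₀ ((one_le_div (by positivity)).2 hq))
    have h₁ : (#{g : GL (Fin n) F | fixedCorank g ∈ S} : ℝ) / Fintype.card (GL (Fin n) F) ≤ 1 :=
      div_le_one_of_le₀ (by exact_mod_cast card_le_univ _) (by positivity)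
    have h₂ : (0 : ℝ) ≤
        (#{g : GL (Fin n) F | fixedCorank g ∈ S} : ℝ) / Fintype.card (GL (Fin n) F) := by
      positivity
    have h₃ : 0 ≤ ∑' k, S.indicator (Qinf (Fintype.card F)) k :=
      tsum_nonneg fun k => Set.indicator_nonneg (fun k _ => Qinf_nonneg F k) k
    have h₄ : ∑' k, S.indicator (Qinf (Fintype.card F)) k ≤ 1 :=
      hsI.tsum_le_of_sum_le fun s => (sum_le_sum fun k _ =>
        Set.indicator_le_self' (fun k _ => Qinf_nonneg F k) k).trans (sum_Qinf_le_one F s)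
    rw [abs_sub_le_iff]
    constructor <;> linarith
  · have hx : (Fintype.card F : ℝ)⁻¹ ≤ 1 / 8 := by
      rw [one_div]
      exact inv_anti₀ (by norm_num) hq
    obtain ⟨hs, hb⟩ := summable_and_tsum_bound (y := 2 * (Fintype.card F : ℝ)⁻¹) (by positivity)
      (by linarith) n
    rw [← ((hasSum_corankProb_indicator n F S).sub hsI.hasSum).tsum_eq]
    have hterm : ∀ k, ‖S.indicator (corankProb (Fintype.card F : ℝ)⁻¹ n) k -
        S.indicator (Qinf (Fintype.card F)) k‖ ≤
          4 / 3 * (2 * (Fintype.card F : ℝ)⁻¹) ^ (k + (n + 1 - k)) := by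
      intro k
      by_cases hk : k ∈ S
      · rw [Set.indicator_of_mem hk, Set.indicator_of_mem hk]
        exact abs_corankProb_sub_Qinf_le hq n k
      · rw [Set.indicator_of_notMem hk, Set.indicator_of_notMem hk, sub_zero, norm_zero]
        positivity
    rw [← Real.norm_eq_abs]
    calc _ ≤ ∑' k, 4 / 3 * (2 * (Fintype.card F : ℝ)⁻¹) ^ (k + (n + 1 - k)) :=
          tsum_of_norm_bounded hs.hasSum hterm
      _ ≤ _ := hb
      _ = (8 / (Fintype.card F : ℝ)) ^ (n + 1) := by congr 1; ring
      _ ≤ (8 / (Fintype.card F : ℝ)) ^ n :=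
          pow_le_pow_of_le_one (by positivity) ((div_le_one (by positivity)).2 hq) n.le_succ
end

section
/- Let q be a prime power, A_n uniformly distributed on GL_n(F_q), with columns X_1, …, X_n, and let 1 ≤ k ≤ l ≤ n. Let X_1', …, X_k' be the restrictions of X_1, …, X_k to their first l coordinates (the same holds for the last l coordinates). Then P(X_1', …, X_k' are linearly independent) ≥ 1 − 2/q^{l−k}. Dually, if X_1'', …, X_l'' are the restrictions of X_1, …, X_l to their first (or last) k coordinates, then P(X_1'', …, X_l'' span F_q^k) ≥ 1 − 2/q^{l−k}. -/
open MeasureTheory ProbabilityTheory Matrix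

/-- `GL` acts transitively on nonzero vectors. -/
theorem Matrix.GeneralLinearGroup.exists_mulVec_eq {ι F : Type*} [Fintype ι] [DecidableEq ι]
    [Field F] {v w : ι → F} (hv : v ≠ 0) (hw : w ≠ 0) :
    ∃ g : GL ι F, (g : Matrix ι ι F) *ᵥ v = w := by
  let e := LinearEquiv.toSpanNonzeroSingleton F (ι → F) v hv
  let e' := LinearEquiv.toSpanNonzeroSingleton F (ι → F) w hw
  obtain ⟨g, hg⟩ := Submodule.exists_linearEquiv_restrict_eq (e.symm ≪≫ₗ e')
  refine ⟨GeneralLinearGroup.toLin.symm (LinearMap.GeneralLinearGroup.ofLinearEquiv g), ?_⟩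
  have hval : ((GeneralLinearGroup.toLin.symm (LinearMap.GeneralLinearGroup.ofLinearEquiv g) :
      GL ι F) : Matrix ι ι F) = LinearMap.toMatrix' (g : (ι → F) →ₗ[F] (ι → F)) := rfl
  rw [hval, LinearMap.toMatrix'_mulVec]
  have hge := hg (e 1)
  rw [LinearEquiv.trans_apply, LinearEquiv.symm_apply_apply] at hge
  simpa [e, e', LinearEquiv.toSpanNonzeroSingleton_apply] using hge.symm

/-- For fixed `v ≠ 0`, all nonzero vectors are attained equally often as `g *ᵥ v`, `g ∈ GL`. -/
theorem Matrix.GeneralLinearGroup.card_filter_mulVec_eq {ι F : Type*} [Fintype ι] [DecidableEq ι]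
    [Field F] [Fintype F] [DecidableEq F] (v : ι → F) {w w' : ι → F} (hw : w ≠ 0) (hw' : w' ≠ 0) :
    (Finset.univ.filter fun g : GL ι F => (g : Matrix ι ι F) *ᵥ v = w).card =
      (Finset.univ.filter fun g : GL ι F => (g : Matrix ι ι F) *ᵥ v = w').card := by
  obtain ⟨h, hh⟩ := exists_mulVec_eq hw hw'
  refine Finset.card_equiv (Equiv.mulLeft h) fun g => ?_
  simp only [Finset.mem_filter, Finset.mem_univ, true_and, Equiv.coe_mulLeft, Units.val_mul,
    ← mulVec_mulVec, ← hh]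
  refine ⟨fun e => by rw [e], fun e => ?_⟩
  have := congrArg (fun x => ((h⁻¹ : GL ι F) : Matrix ι ι F) *ᵥ x) e
  simpa only [mulVec_mulVec, Units.inv_mul, one_mulVec, Units.inv_mul_cancel_left] using this

/-- There are at least `q ^ #κ` times as many nonzero vectors as nonzero vectors vanishing on the
image of `s : κ → ι`. -/
theorem card_filter_ne_zero_vanishing_mul_le {ι κ F : Type*} [Fintype ι] [DecidableEq ι]
    [Fintype κ] [DecidableEq κ] [Field F] [Fintype F] [DecidableEq F] {s : κ → ι}
    (hs : Function.Injective s) :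
    (Finset.univ.filter fun w : ι → F => w ≠ 0 ∧ ∀ j, w (s j) = 0).card *
      Fintype.card F ^ Fintype.card κ ≤ (Finset.univ.filter fun w : ι → F => w ≠ 0).card := by
  rw [← Fintype.card_fun, ← Finset.card_univ, ← Finset.card_product]
  refine Finset.card_le_card_of_injOn
    (fun p : (ι → F) × (κ → F) => p.1 + Function.extend s p.2 0) ?_ ?_
  · rintro ⟨w, u⟩ hp
    simp only [Finset.coe_product, Set.mem_prod, Finset.mem_coe, Finset.mem_filter,
      Finset.mem_univ, true_and, and_true] at hp
    simp only [Finset.mem_coe, Finset.mem_filter, Finset.mem_univ, true_and]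
    obtain ⟨i, hi⟩ := Function.ne_iff.1 hp.1
    have hi' : ¬ ∃ j, s j = i := by
      rintro ⟨j, rfl⟩
      exact hi (hp.2 j)
    refine Function.ne_iff.2 ⟨i, ?_⟩
    simpa [Function.extend_apply' _ _ _ hi'] using hi
  · rintro ⟨w, u⟩ hp ⟨w', u'⟩ hp' e
    simp only [Finset.coe_product, Set.mem_prod, Finset.mem_coe, Finset.mem_filter,
      Finset.mem_univ, true_and, and_true] at hp hp'
    have hu : u = u' := by
      ext j
      simpa [hs.extend_apply, hp.2 j, hp'.2 j] using congrFun e (s j)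
    subst hu
    simpa using e

/-- For fixed `v ≠ 0`, the coordinates of `g *ᵥ v` along `s : κ → ι` all vanish for at most a
proportion `q ^ (-#κ)` of `g ∈ GL`. -/
theorem Matrix.GeneralLinearGroup.card_filter_mulVec_vanishing_mul_le {ι κ F : Type*} [Fintype ι]
    [DecidableEq ι] [Fintype κ] [DecidableEq κ] [Field F] [Fintype F] [DecidableEq F] {s : κ → ι}
    (hs : Function.Injective s) {v : ι → F} (hv : v ≠ 0) :
    (Finset.univ.filter fun g : GL ι F => ∀ j, ((g : Matrix ι ι F) *ᵥ v) (s j) = 0).card *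
      Fintype.card F ^ Fintype.card κ ≤ Fintype.card (GL ι F) := by
  have hne (g : GL ι F) : (g : Matrix ι ι F) *ᵥ v ≠ 0 := fun h => hv <| by
    have := congrArg (fun x => ((g⁻¹ : GL ι F) : Matrix ι ι F) *ᵥ x) h
    simpa only [mulVec_mulVec, Units.inv_mul, one_mulVec, mulVec_zero] using this
  set N := (Finset.univ.filter fun g : GL ι F => (g : Matrix ι ι F) *ᵥ v = v).card
  have h1 : (Finset.univ.filter fun g : GL ι F =>
      ∀ j, ((g : Matrix ι ι F) *ᵥ v) (s j) = 0).card ≤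
      (Finset.univ.filter fun w : ι → F => w ≠ 0 ∧ ∀ j, w (s j) = 0).card * N := by
    rw [Finset.card_eq_sum_card_fiberwise (f := fun g : GL ι F => (g : Matrix ι ι F) *ᵥ v)
      (t := Finset.univ.filter fun w : ι → F => w ≠ 0 ∧ ∀ j, w (s j) = 0)
      (fun g hg => by simpa [hne g] using hg)]
    refine Finset.sum_le_card_nsmul _ _ _ fun w hw => ?_
    refine le_of_le_of_eq ?_ (card_filter_mulVec_eq v (Finset.mem_filter.1 hw).2.1 hv)
    exact Finset.card_le_card (Finset.filter_subset_filter _ (Finset.subset_univ _))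
  have h2 : Fintype.card (GL ι F) = (Finset.univ.filter fun w : ι → F => w ≠ 0).card * N := by
    rw [← Finset.card_univ, Finset.card_eq_sum_card_fiberwise
      (f := fun g : GL ι F => (g : Matrix ι ι F) *ᵥ v)
      (t := Finset.univ.filter fun w : ι → F => w ≠ 0) (fun g _ => by simp [hne g])]
    exact Finset.sum_const_nat fun w hw => card_filter_mulVec_eq v (Finset.mem_filter.1 hw).2 hv
  rw [h2]
  refine (Nat.mul_le_mul_right _ h1).trans ?_
  rw [mul_right_comm]
  exact Nat.mul_le_mul_right _ (card_filter_ne_zero_vanishing_mul_le hs)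

/-- Union bound: few invertible matrices have a submatrix, with columns `r` and rows `s`, whose
columns are linearly dependent. -/
theorem Matrix.GeneralLinearGroup.card_not_linearIndependent_mul_le {ι κ μ F : Type*}
    [Fintype ι] [DecidableEq ι] [Fintype κ] [DecidableEq κ] [Fintype μ] [DecidableEq μ] [Field F]
    [Fintype F] [DecidableEq F] {r : μ → ι} {s : κ → ι} (hr : Function.Injective r)
    (hs : Function.Injective s) (T : Finset (GL ι F))
    (hT : ∀ g ∈ T, ¬ LinearIndependent F fun i j => (g : Matrix ι ι F) (s j) (r i)) :
    T.card * Fintype.card F ^ Fintype.card κ ≤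
      Fintype.card (GL ι F) * Fintype.card F ^ Fintype.card μ := by
  let Z (c : μ → F) : Finset (GL ι F) :=
    Finset.univ.filter fun g : GL ι F =>
      ∀ j, ((g : Matrix ι ι F) *ᵥ Function.extend r c 0) (s j) = 0
  have hsub : T ⊆ (Finset.univ.filter fun c : μ → F => c ≠ 0).biUnion Z := fun g hg => by
    obtain ⟨c, hc, i, hi⟩ := Fintype.not_linearIndependent_iff.1 (hT g hg)
    simp only [Finset.mem_biUnion, Finset.mem_filter, Finset.mem_univ, true_and, Z]
    refine ⟨c, Function.ne_iff.2 ⟨i, hi⟩, fun j => ?_⟩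
    refine Eq.trans ?_ (congrFun hc j)
    rw [mulVec, dotProduct, Finset.sum_apply]
    refine (Fintype.sum_of_injective r hr _ _ (fun i hi => ?_) fun i => ?_).symm
    · rw [Function.extend_apply' _ _ _ hi]; simp
    · rw [hr.extend_apply]; simp [mul_comm]
  calc _ ≤ (∑ c ∈ Finset.univ.filter fun c : μ → F => c ≠ 0, (Z c).card) *
        Fintype.card F ^ Fintype.card κ :=
        Nat.mul_le_mul_right _ ((Finset.card_le_card hsub).trans Finset.card_biUnion_le)
    _ = ∑ c ∈ Finset.univ.filter fun c : μ → F => c ≠ 0,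
        (Z c).card * Fintype.card F ^ Fintype.card κ := Finset.sum_mul ..
    _ ≤ (Finset.univ.filter fun c : μ → F => c ≠ 0).card * Fintype.card (GL ι F) := by
        refine Finset.sum_le_card_nsmul _ _ _ fun c hc => ?_
        refine card_filter_mulVec_vanishing_mul_le hs fun h => (Finset.mem_filter.1 hc).2 ?_
        ext i
        simpa [hr.extend_apply] using congrFun h (r i)
    _ ≤ Fintype.card (μ → F) * Fintype.card (GL ι F) :=
        Nat.mul_le_mul_right _ (Finset.card_le_univ _)
    _ = _ := by rw [Fintype.card_fun, mul_comm]

/-- A matrix with linearly independent rows has spanning columns. -/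
theorem span_range_eq_top_of_linearIndependent_swap {κ μ F : Type*} [Fintype κ] [DecidableEq κ]
    [Field F] {M : μ → κ → F} (h : LinearIndependent F fun j i => M i j) :
    Submodule.span F (Set.range M) = ⊤ := by
  by_contra hne
  obtain ⟨f, hf, hle⟩ := Submodule.exists_le_ker_of_lt_top _ (lt_top_iff_ne_top.2 hne)
  have hfx := LinearMap.pi_apply_eq_sum_univ f
  have h0 := Fintype.linearIndependent_iff.1 h (fun j => f fun i => if j = i then 1 else 0) <| by
    ext i
    have := hle (Submodule.subset_span ⟨i, rfl⟩)
    rw [LinearMap.mem_ker, hfx] at this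
    simpa [mul_comm] using this
  exact hf (LinearMap.ext fun x => by rw [hfx]; simp only [h0]; simp)

/-- The transpose of an invertible matrix, as an invertible matrix. -/
def Matrix.GeneralLinearGroup.transposeUnit {ι F : Type*} [Fintype ι] [DecidableEq ι] [Field F]
    (g : GL ι F) : GL ι F where
  val := (g : Matrix ι ι F)ᵀ
  inv := ((g⁻¹ : GL ι F) : Matrix ι ι F)ᵀ
  val_inv := by rw [← transpose_mul, Units.inv_mul, transpose_one]
  inv_val := by rw [← transpose_mul, Units.mul_inv, transpose_one]

theorem Matrix.GeneralLinearGroup.transposeUnit_injective {ι F : Type*} [Fintype ι]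
    [DecidableEq ι] [Field F] :
    Function.Injective (transposeUnit : GL ι F → GL ι F) := fun _ _ e =>
  Units.ext <| transpose_injective <| congrArg Units.val e

/-- Few invertible matrices have a submatrix, with columns `r` and rows `s`, whose columns do not
span. -/
theorem Matrix.GeneralLinearGroup.card_span_ne_top_mul_le {ι κ μ F : Type*}
    [Fintype ι] [DecidableEq ι] [Fintype κ] [DecidableEq κ] [Fintype μ] [DecidableEq μ] [Field F]
    [Fintype F] [DecidableEq F] {r : μ → ι} {s : κ → ι} (hr : Function.Injective r)
    (hs : Function.Injective s) (T : Finset (GL ι F))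
    (hT : ∀ g ∈ T,
      Submodule.span F (Set.range fun i j => (g : Matrix ι ι F) (s j) (r i)) ≠ ⊤) :
    T.card * Fintype.card F ^ Fintype.card μ ≤
      Fintype.card (GL ι F) * Fintype.card F ^ Fintype.card κ := by
  rw [← Finset.card_image_of_injective T transposeUnit_injective]
  refine card_not_linearIndependent_mul_le hs hr _ fun g hg hli => ?_
  obtain ⟨g', hg', rfl⟩ := Finset.mem_image.1 hg
  exact hT g' hg' (span_range_eq_top_of_linearIndependent_swap hli)

/-- If `X` is uniform on `G` and `p` fails on at most a proportion `ε` of `G`, then `p (X ω)` holds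
with (outer) probability at least `1 - ε`. -/
theorem le_toReal_measure_of_uniform {G Ω : Type*} [Fintype G] [Nonempty G] [MeasurableSpace Ω]
    (P : Measure Ω) [IsProbabilityMeasure P] (X : Ω → G)
    (hX : ∀ b, P {ω | X ω = b} = (Fintype.card G : ENNReal)⁻¹) (p : G → Prop) {ε : ℝ}
    (hp : ∀ T : Finset G, (∀ b ∈ T, ¬ p b) → (T.card : ℝ) ≤ ε * Fintype.card G) :
    1 - ε ≤ (P {ω | p (X ω)}).toReal := by
  classical
  set T := Finset.univ.filter fun b => ¬ p b
  have hT := hp T fun b hb => (Finset.mem_filter.1 hb).2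
  have h1 : P.real {ω | ¬ p (X ω)} ≤ T.card * (Fintype.card G : ℝ)⁻¹ := by
    have : {ω | ¬ p (X ω)} = ⋃ b ∈ T, {ω | X ω = b} := by ext; simp [T]
    rw [this]
    refine (measureReal_biUnion_finset_le _ _).trans_eq ?_
    simp [measureReal_def, hX]
  have h2 : 1 ≤ P.real {ω | p (X ω)} + P.real {ω | ¬ p (X ω)} := by
    refine le_trans (le_of_eq ?_) (measureReal_union_le _ _)
    rw [← probReal_univ (μ := P)]
    congr 1
    ext
    simp [em]
  have h3 : T.card * (Fintype.card G : ℝ)⁻¹ ≤ ε := by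
    rw [← div_eq_mul_inv, div_le_iff₀ (by exact_mod_cast Fintype.card_pos)]
    exact hT
  change _ ≤ P.real _
  linarith

/-- **Submatrices of a uniform invertible matrix are typically of full rank.** For `A` uniform on
`GL_n(F_q)` and `k ≤ l ≤ n`: the restrictions of the first `k` columns to their first (or last)
`l` coordinates are linearly independent with probability at least `1 − 2/q^{l−k}`; dually, the
restrictions of the first `l` columns to their first (or last) `k` coordinates span `F_q^k` with
probability at least `1 − 2/q^{l−k}`. -/
theorem uniform_GL_submatrix_full_rank
    (n k l : ℕ) (hk : 1 ≤ k) (hkl : k ≤ l) (hln : l ≤ n)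
    (F : Type) [Field F] [Fintype F] [DecidableEq F]
    (Ω : Type) [MeasureSpace Ω] (hprob : IsProbabilityMeasure (ℙ : Measure Ω))
    (A : Ω → GL (Fin n) F)
    -- A is uniformly distributed on GL_n(F_q)
    (hunif : ∀ B : GL (Fin n) F,
      ℙ {ω | A ω = B} = ((Fintype.card (GL (Fin n) F) : ENNReal))⁻¹) :
    -- first k columns restricted to the first l coordinates: linearly independent
    (1 - 2 / (Fintype.card F : ℝ) ^ (l - k) ≤
      (ℙ {ω | LinearIndependent F fun i : Fin k => fun j : Fin l =>
        (A ω : Matrix (Fin n) (Fin n) F) (Fin.castLE hln j)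
          (Fin.castLE (hkl.trans hln) i)}).toReal) ∧
    -- first k columns restricted to the last l coordinates: linearly independent
    (1 - 2 / (Fintype.card F : ℝ) ^ (l - k) ≤
      (ℙ {ω | LinearIndependent F fun i : Fin k => fun j : Fin l =>
        (A ω : Matrix (Fin n) (Fin n) F) ⟨n - l + (j : ℕ), by omega⟩
          (Fin.castLE (hkl.trans hln) i)}).toReal) ∧
    -- first l columns restricted to the first k coordinates: spanning
    (1 - 2 / (Fintype.card F : ℝ) ^ (l - k) ≤
      (ℙ {ω | Submodule.span F (Set.range fun i : Fin l => fun j : Fin k =>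
        (A ω : Matrix (Fin n) (Fin n) F) (Fin.castLE (hkl.trans hln) j)
          (Fin.castLE hln i)) = ⊤}).toReal) ∧
    -- first l columns restricted to the last k coordinates: spanning
    (1 - 2 / (Fintype.card F : ℝ) ^ (l - k) ≤
      (ℙ {ω | Submodule.span F (Set.range fun i : Fin l => fun j : Fin k =>
        (A ω : Matrix (Fin n) (Fin n) F) ⟨n - k + (j : ℕ), by omega⟩
          (Fin.castLE hln i)) = ⊤}).toReal) := by
  have hq : (0 : ℝ) < Fintype.card F := by exact_mod_cast Fintype.card_pos
  have bound (c : ℕ) (h : c * Fintype.card F ^ l ≤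
      Fintype.card (GL (Fin n) F) * Fintype.card F ^ k) :
      (c : ℝ) ≤ 2 / (Fintype.card F : ℝ) ^ (l - k) * Fintype.card (GL (Fin n) F) := by
    have h' : (c : ℝ) * (Fintype.card F : ℝ) ^ l ≤
        Fintype.card (GL (Fin n) F) * (Fintype.card F : ℝ) ^ k := by exact_mod_cast h
    rw [← Nat.sub_add_cancel hkl, pow_add, ← mul_assoc] at h'
    have h'' := le_of_mul_le_mul_right h' (pow_pos hq k)
    rw [div_mul_eq_mul_div, le_div_iff₀ (pow_pos hq _)]
    have : (0 : ℝ) ≤ Fintype.card (GL (Fin n) F) := Nat.cast_nonneg _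
    linarith
  have hfirst {m : ℕ} (hm : m ≤ n) : Function.Injective (Fin.castLE hm) :=
    Fin.castLE_injective hm
  have hlast {m : ℕ} (hm : m ≤ n) :
      Function.Injective fun j : Fin m => (⟨n - m + (j : ℕ), by omega⟩ : Fin n) := fun a b e => by
    simpa [Fin.ext_iff] using e
  have hkn := hkl.trans hln
  have independent {s : Fin l → Fin n} (hs : Function.Injective s) :=
    le_toReal_measure_of_uniform ℙ A hunif
      (fun g => LinearIndependent F fun (i : Fin k) (j : Fin l) =>
        (g : Matrix (Fin n) (Fin n) F) (s j) (Fin.castLE hkn i))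
      fun T hT => bound _ <| by
        simpa using GeneralLinearGroup.card_not_linearIndependent_mul_le (hfirst hkn) hs T hT
  have spanning {s : Fin k → Fin n} (hs : Function.Injective s) :=
    le_toReal_measure_of_uniform ℙ A hunif
      (fun g => Submodule.span F (Set.range fun (i : Fin l) (j : Fin k) =>
        (g : Matrix (Fin n) (Fin n) F) (s j) (Fin.castLE hln i)) = ⊤)
      fun T hT => bound _ <| by
        simpa using GeneralLinearGroup.card_span_ne_top_mul_le (hfirst hln) hs T hT
  exact ⟨independent (hfirst hln), independent (hlast hln), spanning (hfirst hkn),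
    spanning (hlast hkn)⟩
end
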